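/- Fix r ∈ ℕ. Then Σ_{n ≤ x} f₂(n) = (C₁ x (log x)^{r−1}/(r−1)!) (1 + O(1/log x)) as x → ∞, where C₁ = Π_p (1 − 1/p)^r · (Σ_{j≥0} τ_r(p^j) τ_{r+1}(p^j)/p^j) / (Σ_{j≥0} τ_r(p^j)²/p^j). -/

import Mathlib

open Filter Finset

/-- `τ_r(n)`, the `r`-th divisor function: the number of ordered `r`-tuples of positive
integers whose product is `n`; equivalently the coefficient of `n^{-s}` in `ζ(s)^r`. -/
noncomputable def tauR (r n : ℕ) : ℕ := (ArithmeticFunction.zeta ^ r : ArithmeticFunction ℕ) n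

/-- The multiplicative function `f₂` determined on prime powers by
`f₂(p^e) = (Σ_{j≥0} τ_r(p^{e+j}) τ_r(p^j)/p^j) / (Σ_{j≥0} τ_r(p^j)²/p^j)`. -/
noncomputable def fTwo (r n : ℕ) : ℝ :=
  ∏ p ∈ n.primeFactors,
    (∑' j : ℕ, ((tauR r (p ^ (n.factorization p + j)) : ℝ) * tauR r (p ^ j)) / p ^ j) /
      (∑' j : ℕ, ((tauR r (p ^ j) : ℝ)) ^ 2 / p ^ j)

/-- `C₁ = Π_p (1 − 1/p)^r (Σ_{j≥0} τ_r(p^j) τ_{r+1}(p^j)/p^j) / (Σ_{j≥0} τ_r(p^j)²/p^j)`. -/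
noncomputable def constC1 (r : ℕ) : ℝ :=
  ∏' p : Nat.Primes,
    ((1 - 1 / ((p : ℕ) : ℝ)) ^ r *
      ((∑' j : ℕ, ((tauR r ((p : ℕ) ^ j) : ℝ) * tauR (r + 1) ((p : ℕ) ^ j)) / (p : ℕ) ^ j) /
        (∑' j : ℕ, ((tauR r ((p : ℕ) ^ j) : ℝ)) ^ 2 / (p : ℕ) ^ j)))

section SummatoryFunctions

/-- Comparison of `∑ m ≤ n, log (x / m) ^ k / m` with the corresponding integral. -/
lemma abs_sum_log_div_pow_sub_le (k : ℕ) {x : ℝ} (hx : 1 ≤ x) :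
    |∑ m ∈ Ioc 0 ⌊x⌋₊, 1 / (m : ℝ) * Real.log (x / m) ^ k - Real.log x ^ (k + 1) / (k + 1)| ≤
      (1 + Real.log x) ^ k := by
  have hlogx : 0 ≤ Real.log x := Real.log_nonneg hx
  have key : ∀ n : ℕ, 1 ≤ n → (n : ℝ) ≤ x →
      (∑ m ∈ Ioc 0 n, 1 / (m : ℝ) * Real.log (x / m) ^ k ≤
        (Real.log x ^ (k + 1) - Real.log (x / n) ^ (k + 1)) / (k + 1) + Real.log x ^ k) ∧
      ((Real.log x ^ (k + 1) - Real.log (x / n) ^ (k + 1)) / (k + 1) +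
        1 / (n : ℝ) * Real.log (x / n) ^ k ≤ ∑ m ∈ Ioc 0 n, 1 / (m : ℝ) * Real.log (x / m) ^ k) := by
    intro n hn
    induction n, hn using Nat.le_induction with
    | base => intro _; simp
    | succ n hn ih =>
      intro hnx
      push_cast at hnx
      have hn0 : (0 : ℝ) < n := by exact_mod_cast hn
      obtain ⟨ih1, ih2⟩ := ih (by linarith)
      rw [Finset.sum_Ioc_succ_top (by omega)]
      push_cast
      set u := Real.log (x / n) with hu
      set v := Real.log (x / (n + 1)) with hv
      have hv0 : 0 ≤ v := Real.log_nonneg (by rw [le_div_iff₀ (by positivity)]; linarith)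
      have huv : u - v = Real.log (1 + 1 / n) := by
        rw [hu, hv, ← Real.log_div (by positivity) (by positivity)]
        congr 1
        field_simp
      have h1 : u - v ≤ 1 / n := by
        rw [huv]
        have := Real.log_le_sub_one_of_pos (x := 1 + 1 / (n : ℝ)) (by positivity)
        linarith
      have h2 : 1 / ((n : ℝ) + 1) ≤ u - v := by
        rw [huv]
        have := Real.one_sub_inv_le_log_of_pos (x := 1 + 1 / (n : ℝ)) (by positivity)
        refine le_trans (le_of_eq ?_) this
        field_simp
        ring
      have huv' : v ≤ u := by
        have : 0 ≤ 1 / ((n : ℝ) + 1) := by positivity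
        linarith
      have hu0 : 0 ≤ u := hv0.trans huv'
      have hgeom : (∑ i ∈ Finset.range (k + 1), u ^ i * v ^ (k - i)) * (u - v) =
          u ^ (k + 1) - v ^ (k + 1) := by
        have := (Commute.all u v).geom_sum₂_mul (k + 1)
        simpa using this
      have hlow : ((k : ℝ) + 1) * v ^ k ≤ ∑ i ∈ Finset.range (k + 1), u ^ i * v ^ (k - i) := by
        have : ∑ i ∈ Finset.range (k + 1), v ^ k = ((k : ℝ) + 1) * v ^ k := by simp
        rw [← this]
        refine Finset.sum_le_sum fun i hi => ?_
        have hi' : i ≤ k := by simpa [Nat.lt_succ_iff] using hi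
        calc v ^ k = v ^ i * v ^ (k - i) := by rw [← pow_add]; congr 1; omega
          _ ≤ _ := by gcongr
      have hupp : ∑ i ∈ Finset.range (k + 1), u ^ i * v ^ (k - i) ≤ ((k : ℝ) + 1) * u ^ k := by
        have : ∑ i ∈ Finset.range (k + 1), u ^ k = ((k : ℝ) + 1) * u ^ k := by simp
        rw [← this]
        refine Finset.sum_le_sum fun i hi => ?_
        have hi' : i ≤ k := by simpa [Nat.lt_succ_iff] using hi
        calc u ^ i * v ^ (k - i) ≤ u ^ i * u ^ (k - i) := by gcongr
          _ = u ^ k := by rw [← pow_add]; congr 1; omega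
      have hk : (0 : ℝ) < k + 1 := by positivity
      have hA : 1 / ((n : ℝ) + 1) * v ^ k ≤ (u ^ (k + 1) - v ^ (k + 1)) / (k + 1) := by
        rw [le_div_iff₀ hk, ← hgeom]
        calc 1 / ((n : ℝ) + 1) * v ^ k * (k + 1) = ((k + 1) * v ^ k) * (1 / ((n : ℝ) + 1)) := by ring
          _ ≤ _ := by
            apply mul_le_mul hlow h2 (by positivity)
            exact le_trans (by positivity) hlow
      have hB : (u ^ (k + 1) - v ^ (k + 1)) / (k + 1) ≤ 1 / (n : ℝ) * u ^ k := by
        rw [div_le_iff₀ hk, ← hgeom]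
        calc _ ≤ ((k + 1) * u ^ k) * (1 / (n : ℝ)) := by
              apply mul_le_mul hupp h1 (by linarith)
              positivity
          _ = _ := by ring
      rw [sub_div] at *
      constructor <;> linarith
  have hN1 : 1 ≤ ⌊x⌋₊ := Nat.one_le_floor_iff x |>.mpr hx
  have hNx : (⌊x⌋₊ : ℝ) ≤ x := Nat.floor_le (by linarith)
  obtain ⟨h1, h2⟩ := key ⌊x⌋₊ hN1 hNx
  set N := ⌊x⌋₊ with hN
  have hN0 : (0 : ℝ) < N := by exact_mod_cast hN1
  have hL0 : 0 ≤ Real.log (x / N) := Real.log_nonneg (by rw [le_div_iff₀ hN0]; linarith)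
  have hL1 : Real.log (x / N) ≤ 1 := by
    have hlt : x < N + 1 := Nat.lt_floor_add_one x
    have h3 := Real.log_le_sub_one_of_pos (x := x / N) (by positivity)
    have h4 : x / N ≤ 2 := by
      rw [div_le_iff₀ hN0]
      have : (1 : ℝ) ≤ N := by exact_mod_cast hN1
      linarith
    linarith
  have hk : (0 : ℝ) < k + 1 := by positivity
  have h5 : Real.log (x / N) ^ (k + 1) / (k + 1) ≤ 1 := by
    rw [div_le_one hk]
    have := pow_le_one₀ (n := k + 1) hL0 hL1
    have : (0 : ℝ) ≤ k := by positivity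
    linarith
  have h6 : 0 ≤ Real.log (x / N) ^ (k + 1) / (k + 1) := by positivity
  have h7 : Real.log x ^ k ≤ (1 + Real.log x) ^ k := by gcongr; linarith
  have h8 : 1 ≤ (1 + Real.log x) ^ k := one_le_pow₀ (by linarith)
  have h9 : 0 ≤ 1 / (N : ℝ) * Real.log (x / N) ^ k := by positivity
  rw [sub_div] at h1 h2
  rw [abs_le]
  constructor <;> linarith

lemma sum_rpow_neg_three_fourths_le (n : ℕ) :
    ∑ m ∈ Ioc 0 n, ((m : ℝ) ^ (3 / 4 : ℝ))⁻¹ ≤ 4 * (n : ℝ) ^ (1 / 4 : ℝ) := by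
  induction n with
  | zero => simp
  | succ n ih =>
    rw [Finset.sum_Ioc_succ_top (by omega)]
    set a := (n : ℝ) ^ (1 / 4 : ℝ) with ha
    set b := ((n + 1 : ℕ) : ℝ) ^ (1 / 4 : ℝ) with hb
    have ha0 : 0 ≤ a := by positivity
    have hb0 : 0 < b := by positivity
    have ha4 : a ^ 4 = n := by
      rw [ha, ← Real.rpow_natCast, ← Real.rpow_mul (by positivity)]; norm_num
    have hb4 : b ^ 4 = n + 1 := by
      rw [hb, ← Real.rpow_natCast, ← Real.rpow_mul (by positivity)]; norm_num
    have hb3 : ((n + 1 : ℕ) : ℝ) ^ (3 / 4 : ℝ) = b ^ 3 := by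
      rw [hb, ← Real.rpow_natCast, ← Real.rpow_mul (by positivity)]; norm_num
    rw [hb3]
    have hab : a ≤ b := by
      rw [ha, hb]; gcongr; simp
    have : (b ^ 3)⁻¹ ≤ 4 * (b - a) := by
      rw [inv_le_iff_one_le_mul₀ (by positivity)]
      have h1 : 1 = (b - a) * (b ^ 3 + b ^ 2 * a + b * a ^ 2 + a ^ 3) := by
        have : 1 = b ^ 4 - a ^ 4 := by rw [ha4, hb4]; ring
        rw [this]; ring
      have h2 : b ^ 3 + b ^ 2 * a + b * a ^ 2 + a ^ 3 ≤ 4 * b ^ 3 := by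
        have e1 : b ^ 2 * a ≤ b ^ 2 * b := by gcongr
        have e2 : b * a ^ 2 ≤ b * b ^ 2 := by gcongr
        have e3 : a ^ 3 ≤ b ^ 3 := by gcongr
        nlinarith
      calc (1 : ℝ) = (b - a) * (b ^ 3 + b ^ 2 * a + b * a ^ 2 + a ^ 3) := h1
        _ ≤ (b - a) * (4 * b ^ 3) := by
          apply mul_le_mul_of_nonneg_left h2; linarith
        _ = _ := by ring
    linarith

open scoped ArithmeticFunction.zeta in
lemma abs_sum_zeta_mul_sub_le (g : ArithmeticFunction ℝ)
    (hg : Summable fun n : ℕ => |g n| / (n : ℝ) ^ (3 / 4 : ℝ)) {x : ℝ} (hx : 1 ≤ x) :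
    |∑ n ∈ Ioc 0 ⌊x⌋₊, ((ζ : ArithmeticFunction ℝ) * g) n - (∑' n : ℕ, g n / n) * x| ≤
      (∑' n : ℕ, |g n| / (n : ℝ) ^ (3 / 4 : ℝ)) * x ^ (3 / 4 : ℝ) := by
  have hbound : ∀ n : ℕ, |g n * ⌊x / n⌋₊ - g n / n * x| ≤
      |g n| / (n : ℝ) ^ (3 / 4 : ℝ) * x ^ (3 / 4 : ℝ) := by
    intro n
    rcases Nat.eq_zero_or_pos n with rfl | hn
    · simp
    have hn0 : (0 : ℝ) < n := by exact_mod_cast hn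
    have hy : 0 < x / n := by positivity
    rw [show g n * ⌊x / n⌋₊ - g n / n * x = g n * (⌊x / n⌋₊ - x / n) by ring, abs_mul,
      show |g n| / (n : ℝ) ^ (3 / 4 : ℝ) * x ^ (3 / 4 : ℝ) = |g n| * (x / n) ^ (3 / 4 : ℝ) by
        rw [Real.div_rpow (by linarith) hn0.le]; ring]
    gcongr
    set y := x / n
    have h1 : (⌊y⌋₊ : ℝ) ≤ y := Nat.floor_le hy.le
    have h2 : y < ⌊y⌋₊ + 1 := Nat.lt_floor_add_one y
    rw [abs_of_nonpos (by linarith)]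
    rcases le_total 1 y with h | h
    · have := Real.one_le_rpow h (z := 3 / 4) (by norm_num)
      linarith
    · have := Real.rpow_le_rpow_of_exponent_ge hy h (y := 1) (z := 3 / 4) (by norm_num)
      rw [Real.rpow_one] at this
      have h0 : (0 : ℝ) ≤ ⌊y⌋₊ := by positivity
      linarith
  have hs : Summable fun n : ℕ => |g n| / (n : ℝ) ^ (3 / 4 : ℝ) * x ^ (3 / 4 : ℝ) := hg.mul_right _
  have hd : Summable fun n : ℕ => g n * ⌊x / n⌋₊ - g n / n * x :=
    Summable.of_norm_bounded hs hbound
  have hvanish : ∀ n ∉ Ioc 0 ⌊x⌋₊, g n * (⌊x / n⌋₊ : ℝ) = 0 := by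
    intro n hn
    rcases Nat.eq_zero_or_pos n with rfl | hn0
    · simp
    rw [Finset.mem_Ioc, not_and, not_le] at hn
    have : ⌊x / n⌋₊ = 0 := by
      rw [Nat.floor_div_natCast]
      exact Nat.div_eq_of_lt (hn hn0)
    simp [this]
  have hfl : HasSum (fun n : ℕ => g n * (⌊x / n⌋₊ : ℝ))
      (∑ n ∈ Ioc 0 ⌊x⌋₊, ((ζ : ArithmeticFunction ℝ) * g) n) := by
    have : HasSum (fun n : ℕ => g n * (⌊x / n⌋₊ : ℝ))
        (∑ n ∈ Ioc 0 ⌊x⌋₊, g n * (⌊x / n⌋₊ : ℝ)) := hasSum_sum_of_ne_finset_zero hvanish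
    rwa [mul_comm, ArithmeticFunction.sum_Ioc_mul_zeta_eq_sum,
      Finset.sum_congr rfl fun n _ => by rw [← Nat.floor_div_natCast]]
  have hgx : Summable fun n : ℕ => g n / n * x := by
    simpa using hfl.summable.sub hd
  have hgx' : Summable fun n : ℕ => g n / (n : ℝ) :=
    (summable_mul_right_iff (by linarith : x ≠ 0)).mp hgx
  rw [← hfl.tsum_eq, ← tsum_mul_right, ← hfl.summable.tsum_sub hgx, ← tsum_mul_right]
  exact tsum_of_norm_bounded (f := fun n : ℕ => g n * ⌊x / n⌋₊ - g n / n * x) hs.hasSum hbound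

open scoped ArithmeticFunction.zeta in
/-- Convolving with `ζ` raises the power of the logarithm in an asymptotic formula by one. -/
lemma abs_sum_zeta_mul_sub_le_of_abs_sum_sub_le (h : ArithmeticFunction ℝ) (k : ℕ) (G K : ℝ)
    (E : ℝ → ℝ) {x : ℝ} (hx : 1 ≤ x)
    (hh : ∀ y : ℝ, 1 ≤ y →
      |∑ n ∈ Ioc 0 ⌊y⌋₊, h n - G * y * Real.log y ^ k / k.factorial| ≤ E y)
    (hE : ∑ m ∈ Ioc 0 ⌊x⌋₊, E (x / m) ≤ K * (x * (1 + Real.log x) ^ k)) :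
    |∑ n ∈ Ioc 0 ⌊x⌋₊, ((ζ : ArithmeticFunction ℝ) * h) n -
      G * x * Real.log x ^ (k + 1) / (k + 1).factorial| ≤
      (K + |G|) * (x * (1 + Real.log x) ^ k) := by
  have hrec : ∑ n ∈ Ioc 0 ⌊x⌋₊, ((ζ : ArithmeticFunction ℝ) * h) n =
      ∑ m ∈ Ioc 0 ⌊x⌋₊, ∑ n ∈ Ioc 0 ⌊x / m⌋₊, h n := by
    rw [ArithmeticFunction.sum_Ioc_mul_eq_sum_sum]
    refine Finset.sum_congr rfl fun m hm => ?_
    have hm0 : m ≠ 0 := by have := (Finset.mem_Ioc.mp hm).1; omega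
    simp [ArithmeticFunction.natCoe_apply, ArithmeticFunction.zeta_apply, hm0,
      Nat.floor_div_natCast]
  have hmain : |∑ m ∈ Ioc 0 ⌊x⌋₊, G * (x / m) * Real.log (x / m) ^ k / k.factorial -
      G * x * Real.log x ^ (k + 1) / (k + 1).factorial| ≤ |G| * (x * (1 + Real.log x) ^ k) := by
    have e1 : ∑ m ∈ Ioc 0 ⌊x⌋₊, G * (x / m) * Real.log (x / m) ^ k / k.factorial -
        G * x * Real.log x ^ (k + 1) / (k + 1).factorial =
        G * x / k.factorial * (∑ m ∈ Ioc 0 ⌊x⌋₊, 1 / (m : ℝ) * Real.log (x / m) ^ k -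
          Real.log x ^ (k + 1) / (k + 1)) := by
      rw [mul_sub, Finset.mul_sum, Nat.factorial_succ]
      congr 1
      · refine Finset.sum_congr rfl fun m _ => by ring
      · push_cast
        have : (k.factorial : ℝ) ≠ 0 := by positivity
        field_simp
    have hf : (1 : ℝ) ≤ k.factorial := by exact_mod_cast Nat.one_le_iff_ne_zero.mpr k.factorial_ne_zero
    rw [e1, abs_mul, ← mul_assoc]
    refine mul_le_mul ?_ (abs_sum_log_div_pow_sub_le k hx) (abs_nonneg _) (by positivity)
    rw [abs_div, abs_mul, abs_of_pos (by linarith : 0 < x), abs_of_pos (by linarith : (0 : ℝ) < k.factorial)]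
    exact div_le_self (by positivity) hf
  have herr : |∑ m ∈ Ioc 0 ⌊x⌋₊, ∑ n ∈ Ioc 0 ⌊x / m⌋₊, h n -
      ∑ m ∈ Ioc 0 ⌊x⌋₊, G * (x / m) * Real.log (x / m) ^ k / k.factorial| ≤
      K * (x * (1 + Real.log x) ^ k) := by
    rw [← Finset.sum_sub_distrib]
    refine (Finset.abs_sum_le_sum_abs _ _).trans (le_trans (Finset.sum_le_sum fun m hm => ?_) hE)
    obtain ⟨hm0, hm1⟩ := Finset.mem_Ioc.mp hm
    have hm0' : (0 : ℝ) < m := by exact_mod_cast hm0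
    refine hh _ ?_
    rw [le_div_iff₀ hm0', one_mul]
    exact (Nat.le_floor_iff (by linarith)).mp hm1
  rw [hrec, add_mul]
  exact (abs_sub_le _ _ _).trans (add_le_add herr hmain)

open scoped ArithmeticFunction.zeta in
lemma exists_abs_sum_zeta_pow_mul_sub_le (g : ArithmeticFunction ℝ)
    (hg : Summable fun n : ℕ => |g n| / (n : ℝ) ^ (3 / 4 : ℝ)) (k : ℕ) :
    ∃ K : ℝ, 0 ≤ K ∧ ∀ x : ℝ, 1 ≤ x →
      |∑ n ∈ Ioc 0 ⌊x⌋₊, ((ζ : ArithmeticFunction ℝ) ^ (k + 2) * g) n -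
        (∑' n : ℕ, g n / n) * x * Real.log x ^ (k + 1) / (k + 1).factorial| ≤
        K * (x * (1 + Real.log x) ^ k) := by
  set G := ∑' n : ℕ, g n / n
  induction k with
  | zero =>
    set K := ∑' n : ℕ, |g n| / (n : ℝ) ^ (3 / 4 : ℝ)
    have hK : 0 ≤ K := tsum_nonneg fun n => by positivity
    refine ⟨K * 4 + |G|, by positivity, fun x hx => ?_⟩
    rw [show (ζ : ArithmeticFunction ℝ) ^ (0 + 2) * g = ζ * (ζ * g) by ring]
    refine abs_sum_zeta_mul_sub_le_of_abs_sum_sub_le _ 0 G _ (fun y => K * y ^ (3 / 4 : ℝ)) hx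
      (fun y hy => by simpa using abs_sum_zeta_mul_sub_le g hg hy) ?_
    have hx0 : 0 ≤ x := by linarith
    calc ∑ m ∈ Ioc 0 ⌊x⌋₊, K * (x / m) ^ (3 / 4 : ℝ)
        = K * x ^ (3 / 4 : ℝ) * ∑ m ∈ Ioc 0 ⌊x⌋₊, ((m : ℝ) ^ (3 / 4 : ℝ))⁻¹ := by
          rw [Finset.mul_sum]
          refine Finset.sum_congr rfl fun m _ => ?_
          rw [Real.div_rpow hx0 (by positivity)]; ring
      _ ≤ K * x ^ (3 / 4 : ℝ) * (4 * x ^ (1 / 4 : ℝ)) := by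
          gcongr
          refine (sum_rpow_neg_three_fourths_le _).trans ?_
          gcongr
          exact Nat.floor_le hx0
      _ = K * 4 * (x ^ (3 / 4 : ℝ) * x ^ (1 / 4 : ℝ)) := by ring
      _ = K * 4 * (x * (1 + Real.log x) ^ 0) := by
          rw [← Real.rpow_add (by linarith)]; norm_num
  | succ k ih =>
    obtain ⟨K, hK, hb⟩ := ih
    refine ⟨K + |G|, by positivity, fun x hx => ?_⟩
    rw [show (ζ : ArithmeticFunction ℝ) ^ (k + 1 + 2) * g = ζ * (ζ ^ (k + 2) * g) by ring]
    refine abs_sum_zeta_mul_sub_le_of_abs_sum_sub_le _ (k + 1) G K _ hx hb ?_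
    have hx0 : 0 ≤ x := by linarith
    have hl : 0 ≤ Real.log x := Real.log_nonneg hx
    calc ∑ m ∈ Ioc 0 ⌊x⌋₊, K * (x / m * (1 + Real.log (x / m)) ^ k)
        ≤ ∑ m ∈ Ioc 0 ⌊x⌋₊, K * (x * (1 + Real.log x) ^ k) * (m : ℝ)⁻¹ := by
          refine Finset.sum_le_sum fun m hm => ?_
          obtain ⟨hm0, hm1⟩ := Finset.mem_Ioc.mp hm
          have hm0' : (1 : ℝ) ≤ m := by exact_mod_cast hm0
          have hmx : (m : ℝ) ≤ x := (Nat.le_floor_iff hx0).mp hm1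
          have h1 : 0 ≤ Real.log (x / m) :=
            Real.log_nonneg (by rw [le_div_iff₀ (by linarith)]; linarith)
          have h2 : Real.log (x / m) ≤ Real.log x :=
            Real.log_le_log (by positivity) (div_le_self hx0 hm0')
          calc K * (x / m * (1 + Real.log (x / m)) ^ k)
              ≤ K * (x / m * (1 + Real.log x) ^ k) := by gcongr
            _ = _ := by ring
      _ = K * (x * (1 + Real.log x) ^ k) * (harmonic ⌊x⌋₊ : ℝ) := by
          rw [← Finset.mul_sum, harmonic_eq_sum_Icc]
          push_cast
          rfl
      _ ≤ K * (x * (1 + Real.log x) ^ k) * (1 + Real.log x) := by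
          gcongr
          exact harmonic_floor_le_one_add_log x hx
      _ = K * (x * (1 + Real.log x) ^ (k + 1)) := by ring

end SummatoryFunctions

section EulerProducts

/-- A nonnegative multiplicative function is summable once its Euler factors are close to `1`. -/
lemma summable_of_multiplicative_of_tsum_prime_pow_le {f b : ℕ → ℝ} (hf0 : ∀ n, 0 ≤ f n)
    (hf1 : f 1 = 1) (hfz : f 0 = 0) (hmul : ∀ {m n : ℕ}, m.Coprime n → f (m * n) = f m * f n)
    (hs : ∀ {p : ℕ}, p.Prime → Summable fun e : ℕ => f (p ^ e))
    (hb0 : ∀ n, 0 ≤ b n) (hb : Summable b)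
    (hle : ∀ p : ℕ, p.Prime → ∑' e : ℕ, f (p ^ e) ≤ 1 + b p) : Summable f := by
  refine summable_of_sum_le (c := Real.exp (∑' n, b n)) hf0 fun u => ?_
  have hs' : ∀ {p : ℕ}, p.Prime → Summable fun e : ℕ => ‖f (p ^ e)‖ := fun hp => (hs hp).norm
  have hE := (EulerProduct.summable_and_hasSum_factoredNumbers_prod_filter_prime_tsum hf1 hmul hs'
    (Finset.range (u.sup id + 1))).2
  set s := Nat.factoredNumbers (Finset.range (u.sup id + 1)) with hsdef
  have hE' : HasSum (s.indicator f) _ := (hasSum_subtype_iff_indicator (f := f)).mp hE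
  calc ∑ n ∈ u, f n = ∑ n ∈ u, s.indicator f n := by
        refine Finset.sum_congr rfl fun n hn => ?_
        rcases Nat.eq_zero_or_pos n with rfl | hn0
        · simp [Set.indicator, hfz]
        · rw [Set.indicator_of_mem]
          rw [hsdef, Nat.mem_factoredNumbers]
          refine ⟨hn0.ne', fun p hp => ?_⟩
          have h1 : p ≤ n := Nat.le_of_mem_primeFactorsList hp
          have h2 : n ≤ u.sup id := Finset.le_sup (f := id) hn
          simp only [Finset.mem_range]
          omega
    _ ≤ _ := sum_le_hasSum u (fun n _ => Set.indicator_nonneg (fun n _ => hf0 n) n) hE'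
    _ ≤ ∏ p ∈ Finset.range (u.sup id + 1) with p.Prime, Real.exp (b p) := by
        refine Finset.prod_le_prod (fun p _ => tsum_nonneg fun e => hf0 _) fun p hp => ?_
        refine (hle p (Finset.mem_filter.mp hp).2).trans ?_
        rw [add_comm]
        exact Real.add_one_le_exp _
    _ = Real.exp (∑ p ∈ Finset.range (u.sup id + 1) with p.Prime, b p) := (Real.exp_sum _ _).symm
    _ ≤ Real.exp (∑' n, b n) := Real.exp_le_exp.mpr (hb.sum_le_tsum _ fun n _ => hb0 n)

lemma summable_add_pow_mul_geometric (k m : ℕ) {c : ℝ} (hc0 : 0 < c) (hc1 : c < 1) :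
    Summable fun n : ℕ => ((n : ℝ) + m) ^ k * c ^ n := by
  have h := (summable_nat_add_iff m).mpr
    (summable_pow_mul_geometric_of_norm_lt_one k (r := c) (by
      rwa [Real.norm_eq_abs, abs_of_pos hc0]))
  refine (h.mul_right ((c ^ m)⁻¹)).congr fun n => ?_
  rw [pow_add]
  push_cast
  have : c ^ m ≠ 0 := by positivity
  field_simp

end EulerProducts

section LocalFactors

variable {r : ℕ} {t : ℕ → ℝ} {x : ℝ}

lemma mul_shift_le (ht0 : ∀ j, 0 ≤ t j) (ht : ∀ j, t j ≤ ((j : ℝ) + 1) ^ r)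
    (e j : ℕ) : t (e + j) * t j ≤ ((e : ℝ) + 1) ^ r * ((j : ℝ) + 1) ^ (2 * r) := by
  calc t (e + j) * t j ≤ (((e + j : ℕ) : ℝ) + 1) ^ r * ((j : ℝ) + 1) ^ r :=
        mul_le_mul (ht _) (ht _) (ht0 _) (by positivity)
    _ ≤ (((e : ℝ) + 1) * ((j : ℝ) + 1)) ^ r * ((j : ℝ) + 1) ^ r := by
        gcongr
        push_cast
        have : (0 : ℝ) ≤ e * j := by positivity
        linarith
    _ = _ := by rw [mul_pow]; ring

lemma summable_mul_shift (ht0 : ∀ j, 0 ≤ t j) (ht : ∀ j, t j ≤ ((j : ℝ) + 1) ^ r)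
    (hx0 : 0 ≤ x) (hx : x ≤ 1 / 2) (e : ℕ) : Summable fun j : ℕ => t (e + j) * t j * x ^ j := by
  have h := (summable_add_pow_mul_geometric (2 * r) 1 (c := 1 / 2) (by norm_num)
    (by norm_num)).mul_left (((e : ℝ) + 1) ^ r)
  refine Summable.of_nonneg_of_le (fun j => mul_nonneg (mul_nonneg (ht0 _) (ht0 _)) (by positivity))
    (fun j => ?_) h
  rw [← mul_assoc, Nat.cast_one]
  exact mul_le_mul (mul_shift_le ht0 ht e j) (pow_le_pow_left₀ hx0 hx j) (by positivity)
    (by positivity)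

lemma tsum_mul_shift_le (ht0 : ∀ j, 0 ≤ t j) (ht : ∀ j, t j ≤ ((j : ℝ) + 1) ^ r)
    (hx0 : 0 ≤ x) (hx : x ≤ 1 / 2) (e : ℕ) : ∑' j : ℕ, t (e + j) * t j * x ^ j ≤
      (∑' j : ℕ, ((j : ℝ) + 1) ^ (2 * r) * (1 / 2) ^ j) * ((e : ℝ) + 1) ^ r := by
  have h := (summable_add_pow_mul_geometric (2 * r) 1 (c := 1 / 2) (by norm_num)
    (by norm_num)).mul_left (((e : ℝ) + 1) ^ r)
  rw [mul_comm, ← tsum_mul_left]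
  refine Summable.tsum_le_tsum (fun j => ?_) (summable_mul_shift ht0 ht hx0 hx e)
    (by simpa using h)
  rw [← mul_assoc]
  exact mul_le_mul (mul_shift_le ht0 ht e j) (pow_le_pow_left₀ hx0 hx j) (by positivity)
    (by positivity)

lemma one_le_tsum_mul_self (ht0 : ∀ j, 0 ≤ t j) (ht : ∀ j, t j ≤ ((j : ℝ) + 1) ^ r)
    (ht1 : t 0 = 1) (hx0 : 0 ≤ x) (hx : x ≤ 1 / 2) : 1 ≤ ∑' j : ℕ, t (0 + j) * t j * x ^ j := by
  have h := (summable_mul_shift ht0 ht hx0 hx 0).le_tsum 0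
    fun j _ => mul_nonneg (mul_nonneg (ht0 _) (ht0 _)) (by positivity)
  simpa [ht1] using h

lemma abs_tsum_div_tsum_sub_le (ht0 : ∀ j, 0 ≤ t j) (ht : ∀ j, t j ≤ ((j : ℝ) + 1) ^ r)
    (ht1 : t 0 = 1) (htr : t 1 = r) (hx0 : 0 ≤ x) (hx : x ≤ 1 / 2) :
    |(∑' j : ℕ, t (1 + j) * t j * x ^ j) / (∑' j : ℕ, t (0 + j) * t j * x ^ j) - r| ≤
      (∑' j : ℕ, ((j : ℝ) + 2) ^ (2 * r) * (1 / 2) ^ j) * (2 ^ r + r) * x := by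
  have hD := one_le_tsum_mul_self ht0 ht ht1 hx0 hx
  have hc : Summable fun j : ℕ => ((j : ℝ) + 2) ^ (2 * r) * (1 / 2) ^ j := by
    simpa using summable_add_pow_mul_geometric (2 * r) 2 (c := 1 / 2) (by norm_num) (by norm_num)
  have htail : ∀ e : ℕ, ∃ R : ℝ, ∑' j : ℕ, t (e + j) * t j * x ^ j = t e + R ∧ 0 ≤ R ∧
      R ≤ (∑' j : ℕ, ((j : ℝ) + 2) ^ (2 * r) * (1 / 2) ^ j) * ((e : ℝ) + 1) ^ r * x := by
    intro e
    have hs := summable_mul_shift ht0 ht hx0 hx e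
    refine ⟨∑' j : ℕ, t (e + (j + 1)) * t (j + 1) * x ^ (j + 1), ?_, ?_, ?_⟩
    · rw [hs.tsum_eq_zero_add]
      simp [ht1]
    · exact tsum_nonneg fun j => mul_nonneg (mul_nonneg (ht0 _) (ht0 _)) (by positivity)
    · rw [← tsum_mul_right, ← tsum_mul_right]
      refine Summable.tsum_le_tsum (fun j => ?_) ((summable_nat_add_iff 1).mpr hs)
        ((hc.mul_right _).mul_right _)
      have h1 := mul_shift_le ht0 ht e (j + 1)
      rw [show (((j + 1 : ℕ) : ℝ) + 1) = j + 2 by push_cast; ring] at h1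
      calc t (e + (j + 1)) * t (j + 1) * x ^ (j + 1)
          ≤ ((e : ℝ) + 1) ^ r * ((j : ℝ) + 2) ^ (2 * r) * ((1 / 2) ^ j * x) := by
            refine mul_le_mul h1 ?_ (by positivity) (by positivity)
            rw [pow_succ]
            gcongr
        _ = _ := by ring
  obtain ⟨R0, h0, h0n, h0b⟩ := htail 0
  obtain ⟨R1, h1, h1n, h1b⟩ := htail 1
  set D := ∑' j : ℕ, t (0 + j) * t j * x ^ j
  set C := ∑' j : ℕ, ((j : ℝ) + 2) ^ (2 * r) * (1 / 2) ^ j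
  rw [h1, htr, div_sub' (by linarith), abs_div, abs_of_pos (by linarith : 0 < D)]
  refine (div_le_self (abs_nonneg _) hD).trans ?_
  rw [h0, ht1]
  have hC : (0 : ℝ) ≤ r := by positivity
  rw [show (r : ℝ) + R1 - (1 + R0) * r = R1 - r * R0 by ring]
  have h2 : r * R0 ≤ r * (C * x) := by
    gcongr
    simpa using h0b
  have h3 : R1 ≤ C * 2 ^ r * x := by
    norm_num at h1b
    exact h1b
  have h4 : 0 ≤ r * R0 := by positivity
  rw [abs_le]
  constructor <;> nlinarith

/-- The generating function of the numbers `∑ j, t (e + j) t j x ^ j`. -/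
lemma hasSum_tsum_mul_shift_mul_pow (ht0 : ∀ j, 0 ≤ t j) (ht : ∀ j, t j ≤ ((j : ℝ) + 1) ^ r)
    (hx0 : 0 ≤ x) (hx : x ≤ 1 / 2) :
    Summable (fun n : ℕ => t n * (∑ i ∈ Finset.range (n + 1), t i) * x ^ n) ∧
    HasSum (fun e : ℕ => (∑' j : ℕ, t (e + j) * t j * x ^ j) * x ^ e)
      (∑' n : ℕ, t n * (∑ i ∈ Finset.range (n + 1), t i) * x ^ n) := by
  set u : ℕ × ℕ → ℝ := fun q => t (q.1 + q.2) * t q.2 * x ^ (q.1 + q.2)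
  have hu : Summable u := by
    have h1 := summable_add_pow_mul_geometric r 1 (c := 1 / 2) (by norm_num) (by norm_num)
    have h2 := summable_add_pow_mul_geometric (2 * r) 1 (c := 1 / 2) (by norm_num) (by norm_num)
    refine Summable.of_nonneg_of_le
      (fun q => mul_nonneg (mul_nonneg (ht0 _) (ht0 _)) (by positivity)) (fun q => ?_)
      (h1.mul_of_nonneg h2 (fun n => by positivity) (fun n => by positivity))
    calc t (q.1 + q.2) * t q.2 * x ^ (q.1 + q.2)
        ≤ ((q.1 : ℝ) + 1) ^ r * ((q.2 : ℝ) + 1) ^ (2 * r) * (1 / 2) ^ (q.1 + q.2) :=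
          mul_le_mul (mul_shift_le ht0 ht _ _) (pow_le_pow_left₀ hx0 hx _) (by positivity)
            (by positivity)
      _ = _ := by rw [pow_add, Nat.cast_one]; ring
  have hrow : HasSum (fun e : ℕ => (∑' j : ℕ, t (e + j) * t j * x ^ j) * x ^ e) (∑' q, u q) := by
    refine hu.hasSum.prod_fiberwise fun e => ?_
    have h := (summable_mul_shift ht0 ht hx0 hx e).hasSum.mul_right (x ^ e)
    have hj : (fun j : ℕ => u (e, j)) = fun j => t (e + j) * t j * x ^ j * x ^ e := by
      funext j
      simp only [u]
      ring
    rwa [hj]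
  have hdiag : HasSum (fun n : ℕ => t n * (∑ i ∈ Finset.range (n + 1), t i) * x ^ n)
      (∑' q, u q) := by
    have h := (Finset.HasAntidiagonal.sigmaAntidiagonalEquivProd (A := ℕ)).hasSum_iff.mpr hu.hasSum
    have h' := h.sigma fun n => hasSum_fintype _
    convert h' using 2 with n
    change _ = ∑ b ∈ (Finset.HasAntidiagonal.antidiagonal n).attach, u b.1
    rw [Finset.sum_attach (Finset.HasAntidiagonal.antidiagonal n) u,
      Finset.Nat.sum_antidiagonal_eq_sum_range_succ_mk, Finset.mul_sum, Finset.sum_mul,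
      ← Finset.sum_range_reflect]
    refine Finset.sum_congr rfl fun i hi => ?_
    have hi' : i ≤ n := by simpa [Nat.lt_succ_iff] using hi
    change _ = t (i + (n - i)) * t (n - i) * x ^ (i + (n - i))
    rw [show i + (n - i) = n by omega, show n + 1 - 1 - i = n - i by omega]
  exact ⟨hdiag.summable, hdiag.tsum_eq ▸ hrow⟩

end LocalFactors

section DivisorFunction

lemma tauR_succ_prime_pow (r : ℕ) {p : ℕ} (hp : p.Prime) (e : ℕ) :
    tauR (r + 1) (p ^ e) = ∑ i ∈ Finset.range (e + 1), tauR r (p ^ i) := by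
  rw [tauR, pow_succ', ArithmeticFunction.zeta_mul_apply, Nat.sum_divisors_prime_pow hp]
  rfl

lemma tauR_one (r : ℕ) : tauR r 1 = 1 :=
  (ArithmeticFunction.isMultiplicative_zeta.pow (k := r)).map_one

lemma tauR_prime (r : ℕ) {p : ℕ} (hp : p.Prime) : tauR r p = r := by
  induction r with
  | zero => simp [tauR, hp.ne_one]
  | succ r ih =>
    have := tauR_succ_prime_pow r hp 1
    rw [pow_one] at this
    rw [this, Finset.sum_range_succ, Finset.sum_range_one, pow_zero, pow_one, tauR_one, ih]
    omega

lemma tauR_prime_pow_le (r : ℕ) {p : ℕ} (hp : p.Prime) (e : ℕ) :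
    tauR r (p ^ e) ≤ (e + 1) ^ r := by
  induction r generalizing e with
  | zero =>
    rw [tauR, pow_zero, ArithmeticFunction.one_apply]
    split_ifs <;> simp
  | succ r ih =>
    rw [tauR_succ_prime_pow r hp]
    calc ∑ i ∈ Finset.range (e + 1), tauR r (p ^ i)
        ≤ ∑ i ∈ Finset.range (e + 1), (e + 1) ^ r := by
          refine Finset.sum_le_sum fun i hi => (ih i).trans ?_
          have : i ≤ e := by simpa [Nat.lt_succ_iff] using hi
          gcongr
      _ = (e + 1) ^ (r + 1) := by simp [pow_succ']

end DivisorFunction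

section MoebiusPowers

open scoped ArithmeticFunction.zeta ArithmeticFunction.Moebius

lemma moebius_mul_prime_pow_succ (f : ArithmeticFunction ℝ) {p : ℕ} (hp : p.Prime) (e : ℕ) :
    ((μ : ArithmeticFunction ℝ) * f) (p ^ (e + 1)) = f (p ^ (e + 1)) - f (p ^ e) := by
  have hf : f = (ζ : ArithmeticFunction ℝ) * ((μ : ArithmeticFunction ℝ) * f) := by
    rw [← mul_assoc, ArithmeticFunction.coe_zeta_mul_coe_moebius, one_mul]
  have key : ∀ e : ℕ, f (p ^ e) =
      ∑ i ∈ Finset.range (e + 1), ((μ : ArithmeticFunction ℝ) * f) (p ^ i) := by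
    intro e
    conv_lhs => rw [hf]
    rw [ArithmeticFunction.coe_zeta_mul_apply, Nat.sum_divisors_prime_pow hp]
  rw [key (e + 1), key e, Finset.sum_range_succ]
  ring

variable {f : ArithmeticFunction ℝ} {p : ℕ}

lemma isMultiplicative_moebius_pow_mul (hf : f.IsMultiplicative) (k : ℕ) :
    ((μ : ArithmeticFunction ℝ) ^ k * f).IsMultiplicative :=
  (ArithmeticFunction.isMultiplicative_moebius.intCast.pow).mul hf

lemma moebius_pow_mul_prime (hf : f.IsMultiplicative) (hp : p.Prime) (k : ℕ) :
    ((μ : ArithmeticFunction ℝ) ^ k * f) p = f p - k := by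
  induction k with
  | zero => simp
  | succ k ih =>
    have := moebius_mul_prime_pow_succ ((μ : ArithmeticFunction ℝ) ^ k * f) hp 0
    rw [zero_add, pow_one, pow_zero, (isMultiplicative_moebius_pow_mul hf k).map_one, ih,
      ← mul_assoc, ← pow_succ'] at this
    rw [this]
    push_cast
    ring

lemma abs_moebius_pow_mul_prime_pow_le (hp : p.Prime) {A : ℝ} {r : ℕ}
    (h : ∀ e : ℕ, |f (p ^ e)| ≤ A * ((e : ℝ) + 1) ^ r) (k e : ℕ) :
    |((μ : ArithmeticFunction ℝ) ^ k * f) (p ^ e)| ≤ 2 ^ k * A * ((e : ℝ) + 1) ^ r := by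
  have hA : 0 ≤ A := by simpa using (abs_nonneg _).trans (h 0)
  induction k generalizing e with
  | zero => simpa using h e
  | succ k ih =>
    rw [pow_succ', mul_assoc]
    cases e with
    | zero =>
      have h1 : ((μ : ArithmeticFunction ℝ) * ((μ : ArithmeticFunction ℝ) ^ k * f)) (p ^ 0) =
          ((μ : ArithmeticFunction ℝ) ^ k * f) (p ^ 0) := by
        simp [ArithmeticFunction.intCoe_apply]
      rw [h1]
      refine (ih 0).trans ?_
      rw [pow_succ']
      have : 0 ≤ 2 ^ k * A := by positivity
      simp
      linarith
    | succ e =>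
      rw [moebius_mul_prime_pow_succ _ hp]
      refine (abs_sub _ _).trans ?_
      have h1 := ih (e + 1)
      have h2 : 2 ^ k * A * ((e : ℝ) + 1) ^ r ≤ 2 ^ k * A * (((e + 1 : ℕ) : ℝ) + 1) ^ r := by
        gcongr
        simp
      have h3 := ih e
      rw [pow_succ' (2 : ℝ) k]
      linarith

lemma hasSum_moebius_pow_mul_prime_pow (hp : p.Prime) {x S : ℝ}
    (h : HasSum (fun e : ℕ => f (p ^ e) * x ^ e) S) (k : ℕ) :
    HasSum (fun e : ℕ => ((μ : ArithmeticFunction ℝ) ^ k * f) (p ^ e) * x ^ e)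
      ((1 - x) ^ k * S) := by
  induction k with
  | zero => simpa using h
  | succ k ih =>
    rw [pow_succ', mul_assoc, pow_succ', mul_assoc]
    set g := (μ : ArithmeticFunction ℝ) ^ k * f
    set T := (1 - x) ^ k * S
    rw [← hasSum_nat_add_iff' 1]
    have h1 := ((hasSum_nat_add_iff' 1).mpr ih).sub (ih.mul_left x)
    have h2 : ((μ : ArithmeticFunction ℝ) * g) 1 = g 1 := by
      simp [ArithmeticFunction.intCoe_apply]
    convert h1 using 1
    · funext e
      rw [moebius_mul_prime_pow_succ g hp]
      ring
    · simp only [Finset.sum_range_one, pow_zero, h2]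
      ring

end MoebiusPowers

section FTwo

open scoped ArithmeticFunction.zeta ArithmeticFunction.Moebius

lemma tauR_prime_pow_cast_le (r : ℕ) {p : ℕ} (hp : p.Prime) (j : ℕ) :
    (tauR r (p ^ j) : ℝ) ≤ ((j : ℝ) + 1) ^ r := by
  exact_mod_cast tauR_prime_pow_le r hp j

lemma inv_prime_le_half {p : ℕ} (hp : p.Prime) : (p : ℝ)⁻¹ ≤ 1 / 2 := by
  rw [one_div]
  have : (2 : ℝ) ≤ p := by exact_mod_cast hp.two_le
  gcongr

lemma one_le_tsum_tauR_mul_self (r : ℕ) {p : ℕ} (hp : p.Prime) :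
    1 ≤ ∑' j : ℕ, (tauR r (p ^ (0 + j)) : ℝ) * tauR r (p ^ j) * (p : ℝ)⁻¹ ^ j :=
  one_le_tsum_mul_self (fun _ => Nat.cast_nonneg _) (tauR_prime_pow_cast_le r hp)
    (by simp [tauR_one]) (by positivity) (inv_prime_le_half hp)

lemma tsum_tauR_sq_eq (r p : ℕ) :
    ∑' j : ℕ, (tauR r (p ^ j) : ℝ) ^ 2 / (p : ℝ) ^ j =
      ∑' j : ℕ, (tauR r (p ^ (0 + j)) : ℝ) * tauR r (p ^ j) * (p : ℝ)⁻¹ ^ j :=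
  tsum_congr fun j => by rw [zero_add, inv_pow, div_eq_mul_inv, sq]

lemma fTwo_prime_pow (r : ℕ) {p : ℕ} (hp : p.Prime) (e : ℕ) :
    fTwo r (p ^ e) = (∑' j : ℕ, (tauR r (p ^ (e + j)) : ℝ) * tauR r (p ^ j) * (p : ℝ)⁻¹ ^ j) /
      ∑' j : ℕ, (tauR r (p ^ (0 + j)) : ℝ) * tauR r (p ^ j) * (p : ℝ)⁻¹ ^ j := by
  rcases eq_or_ne e 0 with rfl | he
  · rw [div_self (by have := one_le_tsum_tauR_mul_self r hp; linarith)]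
    simp [fTwo]
  · rw [fTwo, Nat.primeFactors_prime_pow he hp, Finset.prod_singleton, tsum_tauR_sq_eq]
    simp [hp.factorization_self, div_eq_mul_inv]

lemma fTwo_mul_of_coprime (r : ℕ) {m n : ℕ} (h : m.Coprime n) :
    fTwo r (m * n) = fTwo r m * fTwo r n := by
  rw [fTwo, h.primeFactors_mul, Finset.prod_union h.disjoint_primeFactors, fTwo, fTwo]
  congr 1 <;> refine Finset.prod_congr rfl fun p hp => ?_
  · rw [Nat.factorization_eq_of_coprime_left h (by simpa using hp)]
  · rw [Nat.factorization_eq_of_coprime_right h (by simpa using hp)]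

/-- `fTwo r` as an arithmetic function. -/
noncomputable def fTwoArith (r : ℕ) : ArithmeticFunction ℝ :=
  ⟨fun n => if n = 0 then 0 else fTwo r n, if_pos rfl⟩

lemma fTwoArith_apply (r : ℕ) {n : ℕ} (hn : n ≠ 0) : fTwoArith r n = fTwo r n := if_neg hn

lemma isMultiplicative_fTwoArith (r : ℕ) : (fTwoArith r).IsMultiplicative := by
  rw [ArithmeticFunction.IsMultiplicative.iff_ne_zero]
  refine ⟨by rw [fTwoArith_apply r one_ne_zero]; simp [fTwo], fun {m n} hm hn h => ?_⟩
  rw [fTwoArith_apply r hm, fTwoArith_apply r hn, fTwoArith_apply r (mul_ne_zero hm hn),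
    fTwo_mul_of_coprime r h]

lemma fTwoArith_prime_pow (r : ℕ) {p : ℕ} (hp : p.Prime) (e : ℕ) :
    fTwoArith r (p ^ e) =
      (∑' j : ℕ, (tauR r (p ^ (e + j)) : ℝ) * tauR r (p ^ j) * (p : ℝ)⁻¹ ^ j) /
        ∑' j : ℕ, (tauR r (p ^ (0 + j)) : ℝ) * tauR r (p ^ j) * (p : ℝ)⁻¹ ^ j := by
  rw [fTwoArith_apply r (pow_ne_zero _ hp.ne_zero), fTwo_prime_pow r hp]

lemma exists_abs_fTwoArith_prime_pow_le (r : ℕ) :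
    ∃ A : ℝ, 0 ≤ A ∧ ∀ p : ℕ, p.Prime → ∀ e : ℕ,
      |fTwoArith r (p ^ e)| ≤ A * ((e : ℝ) + 1) ^ r := by
  refine ⟨∑' j : ℕ, ((j : ℝ) + 1) ^ (2 * r) * (1 / 2) ^ j, tsum_nonneg fun j => by positivity,
    fun p hp e => ?_⟩
  have hN : 0 ≤ ∑' j : ℕ, (tauR r (p ^ (e + j)) : ℝ) * tauR r (p ^ j) * (p : ℝ)⁻¹ ^ j :=
    tsum_nonneg fun j => by positivity
  have hD := one_le_tsum_tauR_mul_self r hp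
  rw [fTwoArith_prime_pow r hp, abs_of_nonneg (div_nonneg hN (by linarith))]
  exact (div_le_self hN hD).trans <| tsum_mul_shift_le (t := fun j => (tauR r (p ^ j) : ℝ))
    (fun _ => Nat.cast_nonneg _) (tauR_prime_pow_cast_le r hp) (by positivity)
    (inv_prime_le_half hp) e

lemma exists_abs_fTwoArith_prime_sub_le (r : ℕ) :
    ∃ B : ℝ, 0 ≤ B ∧ ∀ p : ℕ, p.Prime → |fTwoArith r p - r| ≤ B * (p : ℝ)⁻¹ := by
  refine ⟨(∑' j : ℕ, ((j : ℝ) + 2) ^ (2 * r) * (1 / 2) ^ j) * (2 ^ r + r),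
    mul_nonneg (tsum_nonneg fun j => by positivity) (by positivity), fun p hp => ?_⟩
  have h := fTwoArith_prime_pow r hp 1
  rw [pow_one] at h
  rw [h]
  exact abs_tsum_div_tsum_sub_le (t := fun j => (tauR r (p ^ j) : ℝ))
    (fun _ => Nat.cast_nonneg _) (tauR_prime_pow_cast_le r hp) (by simp [tauR_one])
    (by simp [tauR_prime r hp]) (by positivity) (inv_prime_le_half hp)

/-- The Euler factor of `constC1 r` at `p`. -/
noncomputable def eulerFactorC1 (r p : ℕ) : ℝ :=
  (1 - 1 / (p : ℝ)) ^ r *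
    ((∑' j : ℕ, ((tauR r (p ^ j) : ℝ) * tauR (r + 1) (p ^ j)) / p ^ j) /
      (∑' j : ℕ, ((tauR r (p ^ j) : ℝ)) ^ 2 / p ^ j))

lemma tsum_tauR_mul_tauR_succ_eq (r : ℕ) {p : ℕ} (hp : p.Prime) :
    ∑' j : ℕ, ((tauR r (p ^ j) : ℝ) * tauR (r + 1) (p ^ j)) / (p : ℝ) ^ j =
      ∑' j : ℕ, (tauR r (p ^ j) : ℝ) * (∑ i ∈ Finset.range (j + 1), (tauR r (p ^ i) : ℝ)) *
        (p : ℝ)⁻¹ ^ j :=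
  tsum_congr fun j => by
    rw [tauR_succ_prime_pow r hp, inv_pow, div_eq_mul_inv]
    push_cast
    rfl

lemma eulerFactorC1_pos (r : ℕ) {p : ℕ} (hp : p.Prime) : 0 < eulerFactorC1 r p := by
  have h1 := (hasSum_tsum_mul_shift_mul_pow (t := fun j => (tauR r (p ^ j) : ℝ))
    (fun _ => Nat.cast_nonneg _) (tauR_prime_pow_cast_le r hp) (x := (p : ℝ)⁻¹) (by positivity)
    (inv_prime_le_half hp)).1.le_tsum 0 fun j _ => by positivity
  have h2 := one_le_tsum_tauR_mul_self r hp
  have h3 := inv_prime_le_half hp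
  rw [eulerFactorC1, tsum_tauR_mul_tauR_succ_eq r hp, tsum_tauR_sq_eq, one_div]
  refine mul_pos (pow_pos (by linarith) r) (div_pos (lt_of_lt_of_le ?_ h1) (by linarith))
  simp [tauR_one]

lemma hasSum_eulerFactorC1 (r : ℕ) {p : ℕ} (hp : p.Prime) :
    HasSum (fun e : ℕ => ((μ : ArithmeticFunction ℝ) ^ r * fTwoArith r) (p ^ e) * (p : ℝ)⁻¹ ^ e)
      (eulerFactorC1 r p) := by
  rw [eulerFactorC1, tsum_tauR_mul_tauR_succ_eq r hp, tsum_tauR_sq_eq, one_div]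
  refine hasSum_moebius_pow_mul_prime_pow hp ?_ r
  have h := (hasSum_tsum_mul_shift_mul_pow (t := fun j => (tauR r (p ^ j) : ℝ))
    (fun _ => Nat.cast_nonneg _) (tauR_prime_pow_cast_le r hp) (x := (p : ℝ)⁻¹) (by positivity)
    (inv_prime_le_half hp)).2.div_const
    (∑' j : ℕ, (tauR r (p ^ (0 + j)) : ℝ) * tauR r (p ^ j) * (p : ℝ)⁻¹ ^ j)
  simpa only [fTwoArith_prime_pow r hp, div_mul_eq_mul_div] using h

/-- The local bound behind the absolute convergence of the Dirichlet series of
`μ ^ r * fTwoArith r`. -/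
lemma exists_hasSum_abs_moebius_pow_mul_prime_pow_le (r : ℕ) :
    ∃ M : ℝ, 0 ≤ M ∧ ∀ p : ℕ, p.Prime → ∃ R : ℝ, 0 ≤ R ∧ R ≤ M * (p : ℝ) ^ (-(3 / 2) : ℝ) ∧
      HasSum (fun e : ℕ => |((μ : ArithmeticFunction ℝ) ^ r * fTwoArith r) (p ^ (e + 1))| *
        ((p : ℝ) ^ (-(3 / 4) : ℝ)) ^ (e + 1)) R := by
  obtain ⟨A, hA0, hA⟩ := exists_abs_fTwoArith_prime_pow_le r
  obtain ⟨B, hB0, hB⟩ := exists_abs_fTwoArith_prime_sub_le r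
  set c : ℝ := (2 : ℝ) ^ (-(3 / 4) : ℝ) with hc
  have hc0 : 0 < c := by positivity
  have hc1 : c < 1 := Real.rpow_lt_one_of_one_lt_of_neg (by norm_num) (by norm_num)
  have hs : Summable fun e : ℕ => 2 ^ r * A * (((e : ℝ) + 3) ^ r * c ^ e) := by
    simpa using (summable_add_pow_mul_geometric r 3 hc0 hc1).mul_left (2 ^ r * A)
  set C := ∑' e : ℕ, 2 ^ r * A * (((e : ℝ) + 3) ^ r * c ^ e)
  have hC : 0 ≤ C := tsum_nonneg fun e => by positivity
  refine ⟨B + C, by positivity, fun p hp => ?_⟩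
  set g := (μ : ArithmeticFunction ℝ) ^ r * fTwoArith r
  set y : ℝ := (p : ℝ) ^ (-(3 / 4) : ℝ) with hy
  have hp2 : (2 : ℝ) ≤ p := by exact_mod_cast hp.two_le
  have hp0 : (0 : ℝ) < p := by linarith
  have hy0 : 0 < y := by positivity
  have hyc : y ≤ c := Real.rpow_le_rpow_of_nonpos (by norm_num) hp2 (by norm_num)
  have hy2 : (p : ℝ) ^ (-(3 / 2) : ℝ) = y ^ 2 := by
    rw [hy, ← Real.rpow_natCast, ← Real.rpow_mul hp0.le]
    norm_num
  have hxy : (p : ℝ)⁻¹ ≤ y := by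
    rw [hy, ← Real.rpow_neg_one]
    exact Real.rpow_le_rpow_of_exponent_le (by linarith) (by norm_num)
  have hg1 : |g (p ^ 1)| * y ^ 1 ≤ B * y ^ 2 := by
    rw [pow_one, pow_one, moebius_pow_mul_prime (isMultiplicative_fTwoArith r) hp]
    calc |fTwoArith r p - r| * y ≤ B * (p : ℝ)⁻¹ * y := by gcongr; exact hB p hp
      _ ≤ B * y * y := by gcongr
      _ = B * y ^ 2 := by ring
  have hg2 : ∀ e : ℕ, |g (p ^ (e + 1 + 1))| * y ^ (e + 1 + 1) ≤
      2 ^ r * A * (((e : ℝ) + 3) ^ r * c ^ e) * y ^ 2 := by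
    intro e
    have h1 := abs_moebius_pow_mul_prime_pow_le hp (hA p hp) r (e + 1 + 1)
    rw [show ((e + 1 + 1 : ℕ) : ℝ) + 1 = e + 3 by push_cast; ring] at h1
    calc |g (p ^ (e + 1 + 1))| * y ^ (e + 1 + 1)
        ≤ 2 ^ r * A * ((e : ℝ) + 3) ^ r * (c ^ e * y ^ 2) := by
          rw [add_assoc, pow_add y e]
          gcongr
          exact h1
      _ = _ := by ring
  have hs2 : Summable fun e : ℕ => |g (p ^ (e + 1 + 1))| * y ^ (e + 1 + 1) :=
    Summable.of_nonneg_of_le (fun e => by positivity) hg2 (hs.mul_right _)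
  have hs1 : Summable fun e : ℕ => |g (p ^ (e + 1))| * y ^ (e + 1) :=
    (summable_nat_add_iff (f := fun e : ℕ => |g (p ^ (e + 1))| * y ^ (e + 1)) 1).mp hs2
  refine ⟨_, tsum_nonneg fun e => by positivity, ?_, hs1.hasSum⟩
  rw [hs1.tsum_eq_zero_add, hy2, add_mul]
  refine add_le_add hg1 ?_
  rw [← tsum_mul_right]
  exact Summable.tsum_le_tsum hg2 hs2 (hs.mul_right _)

lemma summable_abs_moebius_pow_mul_fTwoArith (r : ℕ) :
    Summable fun n : ℕ => |((μ : ArithmeticFunction ℝ) ^ r * fTwoArith r) n| /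
      (n : ℝ) ^ (3 / 4 : ℝ) := by
  obtain ⟨M, hM, h⟩ := exists_hasSum_abs_moebius_pow_mul_prime_pow_le r
  have hmult := isMultiplicative_moebius_pow_mul (isMultiplicative_fTwoArith r) r
  set g := (μ : ArithmeticFunction ℝ) ^ r * fTwoArith r
  have hpow : ∀ p e : ℕ, |g (p ^ e)| / ((p ^ e : ℕ) : ℝ) ^ (3 / 4 : ℝ) =
      |g (p ^ e)| * ((p : ℝ) ^ (-(3 / 4) : ℝ)) ^ e := by
    intro p e
    rw [div_eq_mul_inv, Nat.cast_pow, ← Real.rpow_neg (by positivity), ← Real.rpow_natCast,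
      ← Real.rpow_natCast, ← Real.rpow_mul (by positivity), ← Real.rpow_mul (by positivity),
      mul_comm (e : ℝ)]
  have hsum : ∀ {p : ℕ}, p.Prime → ∃ R : ℝ, R ≤ M * (p : ℝ) ^ (-(3 / 2) : ℝ) ∧
      HasSum (fun e : ℕ => |g (p ^ e)| / ((p ^ e : ℕ) : ℝ) ^ (3 / 4 : ℝ)) (1 + R) := by
    intro p hp
    obtain ⟨R, -, hR, hs⟩ := h p hp
    refine ⟨R, hR, ?_⟩
    simp_rw [hpow]
    rw [← hasSum_nat_add_iff' 1]
    simpa [hmult.map_one] using hs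
  refine summable_of_multiplicative_of_tsum_prime_pow_le
    (b := fun n : ℕ => M * (n : ℝ) ^ (-(3 / 2) : ℝ)) (fun n => by positivity)
    (by simp [hmult.map_one]) (by simp) (fun {m n} hmn => ?_) (fun hp => ?_)
    (fun n => by positivity) ?_ (fun p hp => ?_)
  · rw [hmult.map_mul_of_coprime hmn, abs_mul, Nat.cast_mul,
      Real.mul_rpow (by positivity) (by positivity)]
    ring
  · obtain ⟨R, -, hs⟩ := hsum hp
    exact hs.summable
  · exact (Real.summable_nat_rpow.mpr (by norm_num)).mul_left M
  · obtain ⟨R, hR, hs⟩ := hsum hp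
    rw [hs.tsum_eq]
    linarith

lemma constC1_pos (r : ℕ) : 0 < constC1 r := by
  obtain ⟨M, hM, h⟩ := exists_hasSum_abs_moebius_pow_mul_prime_pow_le r
  have hmult := isMultiplicative_moebius_pow_mul (isMultiplicative_fTwoArith r) r
  have hle : ∀ p : Nat.Primes,
      ‖eulerFactorC1 r p - 1‖ ≤ M * ((p : ℕ) : ℝ) ^ (-(3 / 2) : ℝ) := by
    rintro ⟨p, hp⟩
    obtain ⟨R, -, hR, hs⟩ := h p hp
    have hE := (hasSum_nat_add_iff' 1).mpr (hasSum_eulerFactorC1 r hp)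
    have hE' : ‖eulerFactorC1 r p - 1‖ ≤ R := by
      simp only [Finset.sum_range_one, pow_zero, hmult.map_one, mul_one] at hE
      rw [← hE.tsum_eq]
      refine tsum_of_norm_bounded hs fun e => ?_
      have hp1 : (1 : ℝ) ≤ p := by exact_mod_cast hp.one_le
      rw [norm_mul, Real.norm_eq_abs, norm_pow, norm_inv, Real.norm_natCast]
      gcongr
      rw [← Real.rpow_neg_one]
      exact Real.rpow_le_rpow_of_exponent_le hp1 (by norm_num)
    exact hE'.trans hR
  have hs : Summable fun p : Nat.Primes => eulerFactorC1 r p - 1 :=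
    Summable.of_norm_bounded ((Nat.Primes.summable_rpow.mpr (by norm_num)).mul_left M) hle
  have hlog := Real.summable_log_one_add_of_summable hs
  simp only [add_sub_cancel] at hlog
  have hexp := Real.rexp_tsum_eq_tprod (fun p : Nat.Primes => eulerFactorC1_pos r p.2) hlog
  change 0 < ∏' p : Nat.Primes, eulerFactorC1 r p
  rw [← hexp]
  exact Real.exp_pos _

lemma constC1_eq_tsum (r : ℕ) :
    constC1 r = ∑' n : ℕ, ((μ : ArithmeticFunction ℝ) ^ r * fTwoArith r) n / n := by
  have hmult := isMultiplicative_moebius_pow_mul (isMultiplicative_fTwoArith r) r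
  have hs := summable_abs_moebius_pow_mul_fTwoArith r
  set g := (μ : ArithmeticFunction ℝ) ^ r * fTwoArith r
  have hs' : Summable fun n : ℕ => ‖g n / n‖ := by
    refine Summable.of_nonneg_of_le (fun n => norm_nonneg _) (fun n => ?_) hs
    rcases Nat.eq_zero_or_pos n with rfl | hn
    · simp
    have hn1 : (1 : ℝ) ≤ n := by exact_mod_cast hn
    rw [norm_div, Real.norm_eq_abs, Real.norm_natCast]
    gcongr
    exact Real.rpow_le_self_of_one_le hn1 (by norm_num)
  have hprod := EulerProduct.eulerProduct_tprod (f := fun n : ℕ => g n / n)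
    (by simp [hmult.map_one])
    (fun {m n} hmn => by
      rw [hmult.map_mul_of_coprime hmn, Nat.cast_mul, mul_div_mul_comm]) hs' (by simp)
  rw [← hprod]
  change ∏' p : Nat.Primes, eulerFactorC1 r p = _
  refine tprod_congr fun p => ?_
  rw [← (hasSum_eulerFactorC1 r p.2).tsum_eq]
  refine tsum_congr fun e => ?_
  rw [Nat.cast_pow, inv_pow, div_eq_mul_inv]

lemma zeta_pow_mul_moebius_pow_mul (r : ℕ) (f : ArithmeticFunction ℝ) :
    (ζ : ArithmeticFunction ℝ) ^ r * ((μ : ArithmeticFunction ℝ) ^ r * f) = f := by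
  rw [← mul_assoc, ← mul_pow, ArithmeticFunction.coe_zeta_mul_coe_moebius, one_pow, one_mul]

lemma sum_fTwoArith_eq (r N : ℕ) :
    ∑ n ∈ Ioc 0 N, fTwoArith r n = ∑ n ∈ Finset.Icc 1 N, fTwo r n := by
  refine Finset.sum_congr rfl fun n hn => fTwoArith_apply r ?_
  have := (Finset.mem_Ioc.mp hn).1
  omega

end FTwo

/-- Fix `r ∈ ℕ`. Then
`Σ_{n ≤ x} f₂(n) = (C₁ x (log x)^{r−1}/(r−1)!) (1 + O(1/log x))` as `x → ∞`. -/
theorem sum_fTwo (r : ℕ) (hr : 1 ≤ r) :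
    (fun x : ℝ =>
        (∑ n ∈ Finset.Icc 1 ⌊x⌋₊, fTwo r n) -
          constC1 r * x * Real.log x ^ (r - 1) / (r - 1).factorial)
      =O[atTop] fun x : ℝ =>
        constC1 r * x * Real.log x ^ (r - 1) / (r - 1).factorial / Real.log x := by
  have hC := constC1_pos r
  have hs := summable_abs_moebius_pow_mul_fTwoArith r
  have hid := zeta_pow_mul_moebius_pow_mul r (fTwoArith r)
  obtain ⟨k, rfl | rfl⟩ : ∃ k, r = 1 ∨ r = k + 2 := ⟨r - 2, by omega⟩
  · have hb : (fun x : ℝ => (∑ n ∈ Finset.Icc 1 ⌊x⌋₊, fTwo 1 n) - constC1 1 * x) =O[atTop]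
        fun x : ℝ => x ^ (3 / 4 : ℝ) := by
      have hC' := constC1_eq_tsum 1
      set g := (ArithmeticFunction.moebius : ArithmeticFunction ℝ) ^ 1 * fTwoArith 1
      refine Asymptotics.IsBigO.of_bound (∑' n : ℕ, |g n| / (n : ℝ) ^ (3 / 4 : ℝ)) ?_
      filter_upwards [eventually_ge_atTop 1] with x hx
      have h := abs_sum_zeta_mul_sub_le g hs hx
      rw [pow_one] at hid
      rw [hid, sum_fTwoArith_eq, ← hC'] at h
      rwa [Real.norm_eq_abs, Real.norm_of_nonneg (by positivity)]
    have hlog : Real.log =O[atTop] fun x : ℝ => x ^ (1 / 4 : ℝ) :=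
      (isLittleO_log_rpow_atTop (by norm_num)).isBigO
    simp only [tsub_self, pow_zero, mul_one, Nat.factorial_zero, Nat.cast_one, div_one]
    refine hb.trans ?_
    obtain ⟨c, hc0, hc⟩ := hlog.exists_pos
    refine Asymptotics.IsBigO.of_bound (c / constC1 1) ?_
    filter_upwards [hc.bound, eventually_gt_atTop 1] with x hx hx1
    have hx0 : 0 < x := by linarith
    have hl : 0 < Real.log x := Real.log_pos hx1
    rw [Real.norm_of_nonneg hl.le, Real.norm_of_nonneg (by positivity)] at hx
    rw [Real.norm_of_nonneg (by positivity), Real.norm_of_nonneg (by positivity)]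
    have : x = x ^ (3 / 4 : ℝ) * x ^ (1 / 4 : ℝ) := by
      rw [← Real.rpow_add hx0]; norm_num
    rw [show c / constC1 1 * (constC1 1 * x / Real.log x) = c * x / Real.log x by field_simp,
      le_div_iff₀ hl]
    calc x ^ (3 / 4 : ℝ) * Real.log x ≤ x ^ (3 / 4 : ℝ) * (c * x ^ (1 / 4 : ℝ)) := by gcongr
      _ = c * (x ^ (3 / 4 : ℝ) * x ^ (1 / 4 : ℝ)) := by ring
      _ = c * x := by rw [← this]
  · obtain ⟨K, hK, hb⟩ := exists_abs_sum_zeta_pow_mul_sub_le _ hs k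
    rw [hid, ← constC1_eq_tsum] at hb
    simp only [show k + 2 - 1 = k + 1 by omega]
    refine Asymptotics.IsBigO.of_bound (K * 2 ^ k * (k + 1).factorial / constC1 (k + 2)) ?_
    filter_upwards [eventually_ge_atTop (Real.exp 1)] with x hx
    have hx1 : 1 ≤ x := (Real.one_le_exp (by norm_num)).trans hx
    have hx0 : 0 < x := by linarith
    have hl : 1 ≤ Real.log x := (Real.le_log_iff_exp_le hx0).mpr hx
    have hl0 : 0 < Real.log x := by linarith
    have h := hb x hx1
    rw [sum_fTwoArith_eq] at h
    rw [Real.norm_eq_abs, Real.norm_of_nonneg (by positivity)]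
    refine h.trans ?_
    have hf : ((k + 1).factorial : ℝ) ≠ 0 := by positivity
    calc K * (x * (1 + Real.log x) ^ k) ≤ K * (x * (2 * Real.log x) ^ k) := by
          gcongr
          linarith
      _ = _ := by
          rw [pow_succ (Real.log x), mul_pow]
          field_simp
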